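/- (Extended Sanov's theorem.) Let X be a Polish space, P and Q Borel probability measures on X, and let y_1, y_2, … be i.i.d. with law P and, independently, x_1, x_2, … i.i.d. with law Q. Let (m_k, n_k) be a sequence of sample sizes with m_k, n_k → ∞ and m_k/(m_k + n_k) → c ∈ (0,1). Then for every set Γ ⊆ P(X) × P(X): limsup_{k→∞} −(1/(m_k+n_k)) log Prob((P̂_{m_k}, Q̂_{n_k}) ∈ Γ) ≤ inf_{(R,S) ∈ int Γ} [ c·D(R‖P) + (1−c)·D(S‖Q) ], and liminf_{k→∞} −(1/(m_k+n_k)) log Prob((P̂_{m_k}, Q̂_{n_k}) ∈ Γ) ≥ inf_{(R,S) ∈ cl Γ} [ c·D(R‖P) + (1−c)·D(S‖Q) ], where int Γ and cl Γ are taken with respect to the product of the weak topologies on P(X) × P(X). -/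

import Mathlib

open MeasureTheory Filter Topology ENNReal
open scoped Classical

noncomputable section
/-- The Kullback-Leibler divergence `D(P‖Q) ∈ [0,∞]`: it equals `∫ log (dP/dQ) dP` when
`P ≪ Q` (and the integral is well defined), and `+∞` otherwise. -/
def klDiv {X : Type*} [MeasurableSpace X] (P Q : Measure X) : ℝ≥0∞ :=
  if P ≪ Q ∧ Integrable (llr P Q) P then ENNReal.ofReal (∫ x, llr P Q x ∂P) else ⊤
/-- The empirical measure `(1/n) ∑_{i<n} δ_{x i}` of a sample, as a probability measure
(junk value for `n = 0`). -/
def empMeas {X : Type*} [MeasurableSpace X] [Nonempty X] (n : ℕ) (x : Fin n → X) :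
    ProbabilityMeasure X :=
  if h : 0 < n then
    ⟨(n : ℝ≥0∞)⁻¹ • ∑ i, Measure.dirac (x i), by
      constructor
      simp only [Measure.smul_apply, smul_eq_mul, Measure.coe_finset_sum, Finset.sum_apply,
        measure_univ, Finset.sum_const, Finset.card_univ, Fintype.card_fin, nsmul_eq_mul, mul_one]
      exact ENNReal.inv_mul_cancel (by exact_mod_cast h.ne') (by simp)⟩
  else ⟨Measure.dirac (Classical.arbitrary X), inferInstance⟩
/-- The exponential decay rate `-(1/n) log p` of a probability `p`, valued in `EReal`
(with `-(1/n) log 0 = ⊤`). -/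
def expRate (n : ℕ) (p : ℝ≥0∞) : EReal := -((((n : ℝ)⁻¹ : ℝ) : EReal) * ENNReal.log p)

theorem klDiv_eq_informationTheory {X : Type*} [MeasurableSpace X] (P Q : Measure X)
    [IsProbabilityMeasure P] [IsProbabilityMeasure Q] :
    klDiv P Q = InformationTheory.klDiv P Q := by
  rw [klDiv, InformationTheory.klDiv_def]
  simp

/-- Young's inequality for the convex conjugates `klFun` and `exp t - 1`. -/
theorem mul_le_klFun_add_exp {h : ℝ} (hh : 0 ≤ h) (t : ℝ) :
    t * h ≤ InformationTheory.klFun h + Real.exp t := by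
  rw [InformationTheory.klFun]
  rcases hh.eq_or_lt with rfl | hpos
  · simp; positivity
  · have h1 := Real.add_one_le_exp (t - Real.log h)
    rw [Real.exp_sub, Real.exp_log hpos, le_div_iff₀ hpos] at h1
    nlinarith

/-- Change of measure: an event of `P`-probability `p` has `R`-probability at most
`(D(R‖P) + exp t * p) / t`. -/
theorem ofReal_mul_measure_le_klDiv_add {Y : Type*} [MeasurableSpace Y] (R P : Measure Y)
    [IsProbabilityMeasure R] [IsProbabilityMeasure P] (t : ℝ) (s : Set Y) :
    ENNReal.ofReal t * R s
      ≤ InformationTheory.klDiv R P + ENNReal.ofReal (Real.exp t) * P s := by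
  by_cases hac : R ≪ P
  swap
  · simp [InformationTheory.klDiv_of_not_ac hac]
  set A := toMeasurable P s
  have hA : MeasurableSet A := measurableSet_toMeasurable P s
  calc ENNReal.ofReal t * R s ≤ ENNReal.ofReal t * R A := by
        gcongr; exact subset_toMeasurable P s
    _ = ∫⁻ y in A, ENNReal.ofReal t * R.rnDeriv P y ∂P := by
        rw [lintegral_const_mul _ (Measure.measurable_rnDeriv R P),
          Measure.setLIntegral_rnDeriv hac]
    _ ≤ ∫⁻ y in A, (ENNReal.ofReal (InformationTheory.klFun (R.rnDeriv P y).toReal)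
          + ENNReal.ofReal (Real.exp t)) ∂P := by
        refine lintegral_mono_ae (ae_restrict_of_ae ?_)
        filter_upwards [Measure.rnDeriv_lt_top R P] with y hy
        rw [← ENNReal.ofReal_add (InformationTheory.klFun_nonneg ENNReal.toReal_nonneg)
          (Real.exp_pos t).le]
        conv_lhs => rw [← ENNReal.ofReal_toReal hy.ne]
        rw [← ENNReal.ofReal_mul' ENNReal.toReal_nonneg]
        exact ENNReal.ofReal_le_ofReal (mul_le_klFun_add_exp ENNReal.toReal_nonneg t)
    _ = (∫⁻ y in A, ENNReal.ofReal (InformationTheory.klFun (R.rnDeriv P y).toReal) ∂P)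
          + ENNReal.ofReal (Real.exp t) * P s := by
        rw [lintegral_add_right _ measurable_const, setLIntegral_const, measure_toMeasurable]
    _ ≤ _ := by
        rw [InformationTheory.klDiv_eq_lintegral_klFun_of_ac hac]
        gcongr
        exact Measure.restrict_le_self

theorem klDiv_prod_le {Y Z : Type*} [MeasurableSpace Y] [MeasurableSpace Z]
    (R P : Measure Y) (S Q : Measure Z) [IsProbabilityMeasure R] [IsProbabilityMeasure P]
    [IsProbabilityMeasure S] [IsProbabilityMeasure Q] :
    InformationTheory.klDiv (R.prod S) (P.prod Q)
      ≤ InformationTheory.klDiv R P + InformationTheory.klDiv S Q := by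
  rw [← Measure.compProd_const, ← Measure.compProd_const,
    InformationTheory.klDiv_compProd_eq_add, Measure.compProd_const, Measure.compProd_const]
  gcongr
  have hswap (T : Measure Z) [IsProbabilityMeasure T] :
      R.prod T = (T.prod R).map Prod.swap := Measure.prod_swap.symm
  rw [hswap S, hswap Q]
  refine (InformationTheory.klDiv_map_le _ _ measurable_swap).trans ?_
  rw [← Measure.compProd_const, ← Measure.compProd_const, InformationTheory.klDiv_compProd_left]

theorem klDiv_pi_le {Y : Type*} [MeasurableSpace Y] (R P : Measure Y)
    [IsProbabilityMeasure R] [IsProbabilityMeasure P] (n : ℕ) :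
    InformationTheory.klDiv (Measure.pi fun _ : Fin n => R) (Measure.pi fun _ : Fin n => P)
      ≤ n * InformationTheory.klDiv R P := by
  induction n with
  | zero =>
    rw [Measure.pi_of_empty, Measure.pi_of_empty]
    simp
  | succ n ih =>
    have h (T : Measure Y) [IsProbabilityMeasure T] :=
      ((measurePreserving_piFinSuccAbove (fun _ : Fin (n + 1) => T) 0).symm).map_eq
    rw [← h R, ← h P]
    refine (InformationTheory.klDiv_map_le _ _ (MeasurableEquiv.measurable _)).trans ?_
    refine (klDiv_prod_le _ _ _ _).trans ?_
    push_cast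
    rw [add_mul, one_mul, add_comm]
    gcongr

theorem lintegral_pi_prod_eq_pow {Y : Type*} [MeasurableSpace Y] (P : Measure Y)
    [IsProbabilityMeasure P] {g : Y → ℝ≥0∞} (hg : Measurable g) (n : ℕ) :
    ∫⁻ x, ∏ i, g (x i) ∂(Measure.pi fun _ : Fin n => P) = (∫⁻ y, g y ∂P) ^ n := by
  induction n with
  | zero => simp
  | succ n ih =>
    rw [← ((measurePreserving_piFinSuccAbove (fun _ : Fin (n + 1) => P) 0).symm).lintegral_comp
      (by fun_prop)]
    simp_rw [Fin.prod_univ_succ]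
    simp only [MeasurableEquiv.piFinSuccAbove_symm_apply, Fin.insertNthEquiv_apply]
    simp only [Fin.insertNth_zero', Fin.cons_zero, Fin.cons_succ]
    rw [lintegral_prod_mul (g := fun x : Fin n → Y => ∏ i, g (x i)) hg.aemeasurable
      (Measurable.aemeasurable (by fun_prop)), ih, pow_succ']

theorem measure_prod_pi_sum_ge_le {Y Z : Type*} [MeasurableSpace Y] [MeasurableSpace Z]
    (P : Measure Y) (Q : Measure Z) [IsProbabilityMeasure P] [IsProbabilityMeasure Q]
    {f : Y → ℝ} {g : Z → ℝ} (hf : Measurable f) (hg : Measurable g) (m n : ℕ) (s : ℝ) :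
    (Measure.pi fun _ : Fin m => P).prod (Measure.pi fun _ : Fin n => Q)
        {p | s ≤ ∑ i, f (p.1 i) + ∑ i, g (p.2 i)}
      ≤ ENNReal.ofReal (Real.exp (-s)) * ((∫⁻ y, ENNReal.ofReal (Real.exp (f y)) ∂P) ^ m
        * (∫⁻ z, ENNReal.ofReal (Real.exp (g z)) ∂Q) ^ n) := by
  set μ := (Measure.pi fun _ : Fin m => P).prod (Measure.pi fun _ : Fin n => Q)
  have key : ∫⁻ p, ENNReal.ofReal (Real.exp (∑ i, f (p.1 i) + ∑ i, g (p.2 i))) ∂μ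
      = (∫⁻ y, ENNReal.ofReal (Real.exp (f y)) ∂P) ^ m
        * (∫⁻ z, ENNReal.ofReal (Real.exp (g z)) ∂Q) ^ n := by
    simp_rw [Real.exp_add, Real.exp_sum, ENNReal.ofReal_mul (Finset.prod_nonneg fun _ _ =>
      (Real.exp_pos _).le), ENNReal.ofReal_prod_of_nonneg fun _ _ => (Real.exp_pos _).le]
    rw [lintegral_prod_mul (f := fun x : Fin m → Y => ∏ i, ENNReal.ofReal (Real.exp (f (x i))))
      (g := fun x : Fin n → Z => ∏ i, ENNReal.ofReal (Real.exp (g (x i))))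
      (Measurable.aemeasurable (by fun_prop)) (Measurable.aemeasurable (by fun_prop)),
      lintegral_pi_prod_eq_pow P (g := fun y =>
      ENNReal.ofReal (Real.exp (f y))) (by fun_prop), lintegral_pi_prod_eq_pow Q
      (g := fun y => ENNReal.ofReal (Real.exp (g y))) (by fun_prop)]
  have hs : {p : (Fin m → Y) × (Fin n → Z) | s ≤ ∑ i, f (p.1 i) + ∑ i, g (p.2 i)}
      ⊆ {p | ENNReal.ofReal (Real.exp s)
        ≤ ENNReal.ofReal (Real.exp (∑ i, f (p.1 i) + ∑ i, g (p.2 i)))} := fun p hp =>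
    ENNReal.ofReal_le_ofReal (Real.exp_le_exp.2 hp)
  calc μ _ ≤ _ := measure_mono hs
    _ = ENNReal.ofReal (Real.exp (-s)) * (ENNReal.ofReal (Real.exp s) * μ {p |
        ENNReal.ofReal (Real.exp s)
        ≤ ENNReal.ofReal (Real.exp (∑ i, f (p.1 i) + ∑ i, g (p.2 i)))}) := by
        rw [← mul_assoc, ← ENNReal.ofReal_mul (Real.exp_pos _).le, ← Real.exp_add]
        simp
    _ ≤ _ := by
        rw [← key]
        gcongr
        exact mul_meas_ge_le_lintegral (by fun_prop) _
theorem integral_empMeas {X : Type*} [MeasurableSpace X] [Nonempty X] {m : ℕ} (hm : 0 < m)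
    (x : Fin m → X) {f : X → ℝ} (hf : Measurable f) :
    ∫ y, f y ∂(empMeas m x : Measure X) = (m : ℝ)⁻¹ * ∑ i, f (x i) := by
  have hsm := hf.stronglyMeasurable
  have : (empMeas m x : Measure X) = (m : ℝ≥0∞)⁻¹ • ∑ i, Measure.dirac (x i) := by
    have h : empMeas m x = _ := dif_pos hm
    rw [h]
    rfl
  rw [this, integral_smul_measure, integral_finsetSum_measure]
  · simp [integral_dirac' f _ hsm]
  · intro i _
    exact integrable_dirac' hsm (by simp)

theorem tendsto_pi_integral_empMeas {X : Type*} [MeasurableSpace X] [Nonempty X]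
    (R : Measure X) [IsProbabilityMeasure R] {f : X → ℝ} (hf : Measurable f) (hf2 : MemLp f 2 R)
    {ε : ℝ} (hε : 0 < ε) :
    Tendsto (fun m : ℕ => (Measure.pi fun _ : Fin m => R)
      {x | ε ≤ |∫ y, f y ∂(empMeas m x : Measure X) - ∫ y, f y ∂ R|}) atTop (𝓝 0) := by
  have hlim : Tendsto (fun m : ℕ =>
      ENNReal.ofReal (ProbabilityTheory.variance f R / ε ^ 2 * (m : ℝ)⁻¹)) atTop (𝓝 0) := by
    rw [← ENNReal.ofReal_zero]
    refine ENNReal.tendsto_ofReal ?_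
    simpa using (tendsto_inv_atTop_nhds_zero_nat (𝕜 := ℝ)).const_mul
      (ProbabilityTheory.variance f R / ε ^ 2)
  refine tendsto_of_tendsto_of_tendsto_of_le_of_le' tendsto_const_nhds hlim
    (Eventually.of_forall fun _ => zero_le) ?_
  filter_upwards [eventually_gt_atTop 0] with m hm
  have hm' : (0 : ℝ) < m := by exact_mod_cast hm
  set μ := Measure.pi fun _ : Fin m => R
  set S : (Fin m → X) → ℝ := ∑ i : Fin m, fun x => f (x i)
  have hmem (i : Fin m) : MemLp (fun x : Fin m → X => f (x i)) 2 μ :=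
    hf2.comp_measurePreserving (measurePreserving_eval (fun _ => R) i)
  have hS : MemLp S 2 μ := memLp_finsetSum' _ fun i _ => hmem i
  have hvar : ProbabilityTheory.variance S μ = m * ProbabilityTheory.variance f R := by
    rw [ProbabilityTheory.variance_sum_pi fun _ => hf2]
    simp
  have hmean : ∫ x, S x ∂μ = m * ∫ y, f y ∂ R := by
    simp only [S, Finset.sum_apply]
    rw [integral_finsetSum _ fun i _ => (hmem i).integrable (by norm_num)]
    have (i : Fin m) : ∫ x, f (x i) ∂μ = ∫ y, f y ∂ R := by
      rw [← (measurePreserving_eval (fun _ : Fin m => R) i).map_eq, integral_map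
        (measurable_pi_apply i).aemeasurable hf.aestronglyMeasurable]
    simp [this]
  have hcheb := ProbabilityTheory.meas_ge_le_variance_div_sq hS (mul_pos hm' hε)
  refine le_trans (measure_mono ?_) (hcheb.trans (ENNReal.ofReal_le_ofReal ?_))
  · intro x hx
    simp only [Set.mem_ofPred_eq] at hx ⊢
    rw [integral_empMeas hm x hf] at hx
    have : S x - ∫ x, S x ∂μ = m * ((m : ℝ)⁻¹ * ∑ i, f (x i) - ∫ y, f y ∂ R) := by
      rw [hmean]
      simp only [S, Finset.sum_apply]
      field_simp
    rw [this, abs_mul, abs_of_pos hm']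
    gcongr
  · rw [hvar]
    apply le_of_eq
    field_simp

/-- Weak law of large numbers for empirical measures in the weak topology. -/
theorem tendsto_pi_empMeas_notMem {X : Type*} [MeasurableSpace X] [TopologicalSpace X]
    [BorelSpace X] [Nonempty X] (R : ProbabilityMeasure X) {U : Set (ProbabilityMeasure X)}
    (hU : U ∈ 𝓝 R) :
    Tendsto (fun m : ℕ => (Measure.pi fun _ : Fin m => (R : Measure X)) {x | empMeas m x ∉ U})
      atTop (𝓝 0) := by
  let F : Filter (ProbabilityMeasure X) :=
    { sets := {V | Tendsto (fun m : ℕ => (Measure.pi fun _ : Fin m => (R : Measure X))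
        {x | empMeas m x ∉ V}) atTop (𝓝 0)}
      univ_sets := by simp
      sets_of_superset := fun {V W} hV hVW =>
        tendsto_of_tendsto_of_tendsto_of_le_of_le tendsto_const_nhds hV (fun _ => zero_le)
          fun m => measure_mono fun x hx h => hx (hVW h)
      inter_sets := fun {V W} hV hW => by
        have hVW := Tendsto.add hV hW
        rw [add_zero] at hVW
        refine tendsto_of_tendsto_of_tendsto_of_le_of_le tendsto_const_nhds hVW
          (fun _ => zero_le) fun m => (measure_mono ?_).trans (measure_union_le _ _)
        intro x hx
        by_contra hcon
        simp only [Set.mem_union, Set.mem_ofPred_eq, not_or, not_not] at hcon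
        exact hx hcon }
  have hF : Tendsto (fun S : ProbabilityMeasure X => S) F (𝓝 R) := by
    rw [ProbabilityMeasure.tendsto_iff_forall_integral_tendsto]
    intro f
    rw [Metric.tendsto_nhds]
    intro ε hε
    have h := tendsto_pi_integral_empMeas (R : Measure X) f.continuous.measurable
      (MemLp.of_bound f.continuous.aestronglyMeasurable ‖f‖
        (Eventually.of_forall f.norm_coe_le_norm)) hε
    refine h.congr fun m => ?_
    congr 1
    ext x
    simp [Real.dist_eq]
  exact hF hU

theorem exists_boundedContinuous_integral_sub_integral_exp_gt {X : Type*} [MeasurableSpace X]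
    [TopologicalSpace X] [PolishSpace X] [BorelSpace X] (R P : Measure X)
    [IsProbabilityMeasure R] [IsProbabilityMeasure P] {f : X → ℝ} (hf : Measurable f) {M : ℝ}
    (hM : ∀ x, |f x| ≤ M) {a : ℝ} (ha : a < ∫ x, f x ∂ R - ∫ x, (Real.exp (f x) - 1) ∂P) :
    ∃ g : BoundedContinuousFunction X ℝ, a < ∫ x, g x ∂ R - ∫ x, (Real.exp (g x) - 1) ∂P := by
  let := TopologicalSpace.upgradeIsCompletelyMetrizable X
  set J := ∫ x, f x ∂ R - ∫ x, (Real.exp (f x) - 1) ∂P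
  set δ := (J - a) / (2 * (1 + Real.exp M)) with hδ
  have hden : 0 < 2 * (1 + Real.exp M) := by positivity
  have hδ0 : 0 < δ := div_pos (sub_pos.2 ha) hden
  have hfint (T : Measure X) [IsFiniteMeasure T] : Integrable f T :=
    Integrable.of_bound hf.aestronglyMeasurable M (Eventually.of_forall hM)
  obtain ⟨g₀, hg₀, -⟩ := (hfint (R + P)).exists_boundedContinuous_integral_sub_le hδ0
  let g : BoundedContinuousFunction X ℝ := (g₀ ⊓ .const X M) ⊔ .const X (-M)
  have hg (x : X) : g x = max (min (g₀ x) M) (-M) := rfl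
  have hgM (x : X) : g x ≤ M := by
    rw [hg]
    exact max_le (min_le_right _ _) (by linarith [(abs_nonneg _).trans (hM x)])
  have hfg (x : X) : |f x - g x| ≤ |f x - g₀ x| := by
    have := abs_le.1 (hM x)
    rw [hg]
    rcases max_cases (min (g₀ x) M) (-M) with h | h <;> rcases min_cases (g₀ x) M with h' | h' <;>
    rw [h.1] <;> try rw [h'.1] at h ⊢
    all_goals
      rcases abs_cases (f x - g₀ x) with h2 | h2 <;> rw [abs_le] <;> constructor <;> linarith
  have hgint (T : Measure X) [IsFiniteMeasure T] : Integrable g T := g.integrable T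
  have hg0int (T : Measure X) [IsFiniteMeasure T] : Integrable (fun x => ‖f x - g₀ x‖) T :=
    ((hfint T).sub (g₀.integrable T)).norm
  have hfgint (T : Measure X) [IsFiniteMeasure T] : Integrable (fun x => |f x - g x|) T :=
    ((hfint T).sub (hgint T)).abs
  have hsum : ∫ x, ‖f x - g₀ x‖ ∂ R + ∫ x, ‖f x - g₀ x‖ ∂P ≤ δ := by
    rwa [integral_add_measure (hg0int R) (hg0int P)] at hg₀
  have hR : ∫ x, |f x - g x| ∂ R ≤ δ := by
    have h1 : ∫ x, |f x - g x| ∂ R ≤ ∫ x, ‖f x - g₀ x‖ ∂ R :=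
      integral_mono (hfgint R) (hg0int R) hfg
    have h2 : 0 ≤ ∫ x, ‖f x - g₀ x‖ ∂P := integral_nonneg fun _ => norm_nonneg _
    linarith
  have hP : ∫ x, |f x - g x| ∂P ≤ δ := by
    have h1 : ∫ x, |f x - g x| ∂P ≤ ∫ x, ‖f x - g₀ x‖ ∂P :=
      integral_mono (hfgint P) (hg0int P) hfg
    have h2 : 0 ≤ ∫ x, ‖f x - g₀ x‖ ∂ R := integral_nonneg fun _ => norm_nonneg _
    linarith
  have hexp {k : X → ℝ} (hk : Measurable k) (hkM : ∀ x, k x ≤ M) :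
      Integrable (fun x => Real.exp (k x) - 1) P := by
    refine (Integrable.of_bound (by fun_prop) (Real.exp M) (Eventually.of_forall fun x => ?_)).sub
      (integrable_const 1)
    rw [Real.norm_eq_abs, abs_of_pos (Real.exp_pos _)]
    exact Real.exp_le_exp.2 (hkM x)
  have hJ1 : ∫ x, f x ∂ R - ∫ x, g x ∂ R ≤ δ := by
    rw [← integral_sub (hfint R) (hgint R)]
    exact (integral_mono ((hfint R).sub (hgint R)) (hfgint R) fun x => le_abs_self _).trans hR
  have hJ2 : ∫ x, (Real.exp (g x) - 1) ∂P - ∫ x, (Real.exp (f x) - 1) ∂P ≤ Real.exp M * δ := by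
    have hgi := hexp g.continuous.measurable hgM
    have hfi := hexp hf fun x => (le_abs_self _).trans (hM x)
    rw [← integral_sub hgi hfi]
    calc _ ≤ ∫ x, Real.exp M * |f x - g x| ∂P := by
          refine integral_mono (hgi.sub hfi) ((hfgint P).const_mul _) fun x => ?_
          have h1 := Real.add_one_le_exp (f x - g x)
          have h2 : Real.exp (f x) = Real.exp (g x) * Real.exp (f x - g x) := by
            rw [← Real.exp_add]; ring_nf
          have h3 : Real.exp (g x) * |f x - g x| ≤ Real.exp M * |f x - g x| := by
            gcongr; exact hgM x
          have h4 := neg_abs_le (f x - g x)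
          have h5 := Real.exp_pos (g x)
          simp only
          nlinarith
      _ ≤ _ := by
          rw [integral_const_mul]
          gcongr
  refine ⟨g, ?_⟩
  have : δ + Real.exp M * δ = (J - a) / 2 := by
    rw [hδ]; field_simp
  linarith

theorem exists_measurable_integral_sub_integral_exp_gt {X : Type*} [MeasurableSpace X]
    (R P : Measure X) [IsProbabilityMeasure R] [IsProbabilityMeasure P] {b : ℝ≥0∞}
    (hb : b < InformationTheory.klDiv R P) :
    ∃ f : X → ℝ, Measurable f ∧ (∃ M : ℝ, ∀ x, |f x| ≤ M) ∧
      b < ENNReal.ofReal (∫ x, f x ∂ R - ∫ x, (Real.exp (f x) - 1) ∂P) := by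
  by_cases hac : R ≪ P
  swap
  · have : ∃ A, MeasurableSet A ∧ P A = 0 ∧ R A ≠ 0 := by
      by_contra! h
      exact hac (Measure.AbsolutelyContinuous.mk h)
    obtain ⟨A, hA, hPA, hRA⟩ := this
    have hRA' : 0 < R.real A := ENNReal.toReal_pos hRA (measure_ne_top _ _)
    set t := (b.toReal + 1) / R.real A
    refine ⟨A.indicator fun _ => t, measurable_const.indicator hA, ⟨|t|, fun x => ?_⟩, ?_⟩
    · by_cases hx : x ∈ A <;> simp [hx]
    · have h1 : ∫ x, (Real.exp (A.indicator (fun _ => t) x) - 1) ∂P = 0 := by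
        refine integral_eq_zero_of_ae ?_
        filter_upwards [measure_eq_zero_iff_ae_notMem.1 hPA] with x hx
        simp [hx]
      rw [h1, integral_indicator_const _ hA, smul_eq_mul, sub_zero,
        mul_div_cancel₀ _ hRA'.ne']
      rw [← ENNReal.ofReal_toReal hb.ne_top]
      exact (ENNReal.ofReal_lt_ofReal_iff (by positivity)).2 (by simp)
  set h : X → ℝ := fun x => (R.rnDeriv P x).toReal
  have hh : Measurable h := (Measure.measurable_rnDeriv R P).ennreal_toReal
  have hh0 (x : X) : 0 ≤ h x := ENNReal.toReal_nonneg
  let g : ℕ → X → ℝ := fun n x => max (min (h x) (Real.exp n)) (Real.exp (-n))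
  have hg (n : ℕ) : Measurable (g n) := (hh.min measurable_const).max measurable_const
  have hglow (n : ℕ) (x : X) : Real.exp (-n) ≤ g n x := le_max_right _ _
  have hghigh (n : ℕ) (x : X) : g n x ≤ Real.exp n :=
    max_le (min_le_right _ _) (Real.exp_le_exp.2 (by linarith [n.cast_nonneg (α := ℝ)]))
  have hg0 (n : ℕ) (x : X) : 0 < g n x := (Real.exp_pos _).trans_le (hglow n x)
  have hlog (n : ℕ) (x : X) : |Real.log (g n x)| ≤ n := by
    rw [abs_le]
    exact ⟨(Real.le_log_iff_exp_le (hg0 n x)).2 (hglow n x),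
      (Real.log_le_iff_le_exp (hg0 n x)).2 (hghigh n x)⟩
  let φ : ℕ → X → ℝ := fun n x => h x * Real.log (g n x) - (g n x - 1)
  have hφ0 (n : ℕ) (x : X) : 0 ≤ φ n x := by
    have hk := InformationTheory.klFun_nonneg (hg0 n x).le
    rw [InformationTheory.klFun] at hk
    have h2 : 0 ≤ (h x - g n x) * Real.log (g n x) := by
      rcases le_total (h x) (Real.exp (-n)) with h1 | h1
      · have : g n x = Real.exp (-n) := max_eq_right ((min_le_left _ _).trans h1)
        rw [this, Real.log_exp]
        exact mul_nonneg_of_nonpos_of_nonpos (by linarith) (by simp)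
      rcases le_total (h x) (Real.exp n) with h3 | h3
      · have : g n x = h x := by
          simp only [g]
          rw [min_eq_left h3, max_eq_left h1]
        simp [this]
      · have : g n x = Real.exp n := by
          simp only [g]
          rw [min_eq_right h3, max_eq_left (Real.exp_le_exp.2 (by
            linarith [n.cast_nonneg (α := ℝ)]))]
        rw [this, Real.log_exp]
        exact mul_nonneg (by linarith) (by simp)
    simp only [φ]
    nlinarith
  have hlim (x : X) : Tendsto (fun n => ENNReal.ofReal (φ n x)) atTop
      (𝓝 (ENNReal.ofReal (InformationTheory.klFun (h x)))) := by
    refine ENNReal.tendsto_ofReal ?_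
    have hexp0 : Tendsto (fun n : ℕ => Real.exp (-(n : ℝ))) atTop (𝓝 0) :=
      Real.tendsto_exp_neg_atTop_nhds_zero.comp tendsto_natCast_atTop_atTop
    rcases (hh0 x).eq_or_lt with h0 | h0
    · rw [← h0, InformationTheory.klFun_zero]
      have : ∀ n, φ n x = 1 - Real.exp (-n) := fun n => by
        simp only [φ, g, ← h0]
        rw [min_eq_left (Real.exp_pos _).le, max_eq_right (Real.exp_pos _).le]
        ring
      simp_rw [this]
      simpa using hexp0.const_sub 1
    · refine tendsto_const_nhds.congr' ?_
      filter_upwards [hexp0.eventually_le_const h0,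
        (Real.tendsto_exp_atTop.comp tendsto_natCast_atTop_atTop).eventually_ge_atTop (h x)]
        with n h1 h3
      have h3' : h x ≤ Real.exp n := h3
      have : g n x = h x := by
        simp only [g]
        rw [min_eq_left h3', max_eq_left h1]
      simp only [φ, this, InformationTheory.klFun]
      ring
  have hlogint (n : ℕ) : Integrable (fun x => Real.log (g n x)) R :=
    Integrable.of_bound (Real.measurable_log.comp (hg n)).aestronglyMeasurable n
      (Eventually.of_forall (hlog n))
  have hgint (n : ℕ) : Integrable (fun x => g n x - 1) P := by
    refine (Integrable.of_bound (hg n).aestronglyMeasurable (Real.exp n)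
      (Eventually.of_forall fun x => ?_)).sub (integrable_const 1)
    rw [Real.norm_eq_abs, abs_of_pos (hg0 n x)]
    exact hghigh n x
  have hhlog (n : ℕ) : Integrable (fun x => h x * Real.log (g n x)) P :=
    (integrable_toReal_rnDeriv_mul_iff hac).2 (hlogint n)
  have hφint (n : ℕ) : ∫⁻ x, ENNReal.ofReal (φ n x) ∂P
      = ENNReal.ofReal (∫ x, Real.log (g n x) ∂ R
        - ∫ x, (Real.exp (Real.log (g n x)) - 1) ∂P) := by
    have hφi : Integrable (φ n) P := (hhlog n).sub (hgint n)
    rw [← ofReal_integral_eq_lintegral_ofReal hφi (Eventually.of_forall (hφ0 n))]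
    simp_rw [fun x => Real.exp_log (hg0 n x)]
    rw [← integral_toReal_rnDeriv_mul hac, ← integral_sub (hhlog n) (hgint n)]
  have hfatou : InformationTheory.klDiv R P
      ≤ liminf (fun n => ∫⁻ x, ENNReal.ofReal (φ n x) ∂P) atTop := by
    rw [InformationTheory.klDiv_eq_lintegral_klFun_of_ac hac]
    calc _ = ∫⁻ x, liminf (fun n => ENNReal.ofReal (φ n x)) atTop ∂P :=
          lintegral_congr fun x => (hlim x).liminf_eq.symm
      _ ≤ _ := lintegral_liminf_le fun n =>
          ((hh.mul (Real.measurable_log.comp (hg n))).sub ((hg n).sub_const 1)).ennreal_ofReal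
  obtain ⟨n, hn⟩ := (eventually_lt_of_lt_liminf (hb.trans_le hfatou)).exists
  rw [hφint] at hn
  exact ⟨fun x => Real.log (g n x), Real.measurable_log.comp (hg n), ⟨n, hlog n⟩, hn⟩

/-- A weak form of the Donsker–Varadhan variational formula. -/
theorem klDiv_le_iSup_boundedContinuous {X : Type*} [MeasurableSpace X]
    [TopologicalSpace X] [PolishSpace X] [BorelSpace X] (R P : Measure X)
    [IsProbabilityMeasure R] [IsProbabilityMeasure P] :
    InformationTheory.klDiv R P ≤ ⨆ g : {g : BoundedContinuousFunction X ℝ //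
        0 ≤ ∫ x, g x ∂ R - ∫ x, (Real.exp (g x) - 1) ∂P},
      ENNReal.ofReal (∫ x, g.1 x ∂ R - ∫ x, (Real.exp (g.1 x) - 1) ∂P) := by
  refine le_of_forall_lt fun b hb => ?_
  obtain ⟨f, hf, ⟨M, hM⟩, hbf⟩ := exists_measurable_integral_sub_integral_exp_gt R P hb
  obtain ⟨g, hg⟩ := exists_boundedContinuous_integral_sub_integral_exp_gt R P hf hM
    ((ENNReal.lt_ofReal_iff_toReal_lt hb.ne_top).1 hbf)
  exact lt_iSup_iff.2 ⟨⟨g, ENNReal.toReal_nonneg.trans hg.le⟩,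
    (ENNReal.lt_ofReal_iff_toReal_lt hb.ne_top).2 hg⟩

theorem expRate_anti (N : ℕ) : Antitone (expRate N) := fun p q h => by
  rw [expRate, expRate, EReal.neg_le_neg_iff]
  exact mul_le_mul_of_nonneg_left (ENNReal.log_le_log h)
    (EReal.coe_nonneg.2 (by positivity))

theorem expRate_ofReal_exp {N : ℕ} (hN : 0 < N) (b : ℝ) :
    expRate N (ENNReal.ofReal (Real.exp (-(N * b)))) = b := by
  rw [expRate, ENNReal.log_ofReal_of_pos (Real.exp_pos _), Real.log_exp, ← EReal.coe_mul,
    ← EReal.coe_neg]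
  have : (N : ℝ) ≠ 0 := by positivity
  congr 1
  field_simp

theorem tendsto_div_add_one_sub {m n : ℕ → ℕ} (hm : Tendsto m atTop atTop) {c : ℝ}
    (hc : Tendsto (fun j : ℕ => (m j : ℝ) / (m j + n j)) atTop (𝓝 c)) :
    Tendsto (fun j : ℕ => (n j : ℝ) / (m j + n j)) atTop (𝓝 (1 - c)) := by
  refine (hc.const_sub 1).congr' ?_
  filter_upwards [hm.eventually_gt_atTop 0] with j hj
  have : (0 : ℝ) < m j := Nat.cast_pos.2 hj
  have : (m j : ℝ) + n j ≠ 0 := by positivity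
  field_simp
  ring

theorem one_le_prod_add_measure_add_measure {Y Z : Type*} [MeasurableSpace Y]
    [MeasurableSpace Z] (μ : Measure Y) (ν : Measure Z) [IsProbabilityMeasure μ]
    [IsProbabilityMeasure ν] {A : Set (Y × Z)} {B : Set Y} {B' : Set Z}
    (h : ∀ p, p.1 ∉ B → p.2 ∉ B' → p ∈ A) : 1 ≤ μ.prod ν A + (μ B + ν B') := by
  calc (1 : ℝ≥0∞) = μ.prod ν Set.univ := measure_univ.symm
    _ ≤ μ.prod ν (A ∪ (B ×ˢ Set.univ ∪ Set.univ ×ˢ B')) := by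
        refine measure_mono fun p _ => ?_
        by_cases h1 : p.1 ∈ B
        · simp [h1]
        by_cases h2 : p.2 ∈ B'
        · simp [h2]
        exact Or.inl (h p h1 h2)
    _ ≤ μ.prod ν A + (μ.prod ν (B ×ˢ Set.univ) + μ.prod ν (Set.univ ×ˢ B')) :=
        (measure_union_le _ _).trans (by gcongr; exact measure_union_le _ _)
    _ = _ := by simp [Measure.prod_prod]

theorem eventually_expRate_le_of_mem_interior {X : Type*} [MeasurableSpace X]
    [TopologicalSpace X] [BorelSpace X] [Nonempty X]
    (P Q : Measure X) [IsProbabilityMeasure P] [IsProbabilityMeasure Q]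
    {m n : ℕ → ℕ} (hm : Tendsto m atTop atTop) (hn : Tendsto n atTop atTop)
    {c : ℝ} (hc0 : 0 < c) (hc1 : c < 1)
    (hc : Tendsto (fun j : ℕ => (m j : ℝ) / (m j + n j)) atTop (𝓝 c))
    {Γ : Set (ProbabilityMeasure X × ProbabilityMeasure X)} {R S : ProbabilityMeasure X}
    (hRS : (R, S) ∈ interior Γ) {b : ℝ}
    (hb : ENNReal.ofReal c * InformationTheory.klDiv (R : Measure X) P
      + ENNReal.ofReal (1 - c) * InformationTheory.klDiv (S : Measure X) Q < ENNReal.ofReal b) :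
    ∀ᶠ j in atTop, expRate (m j + n j)
      ((Measure.pi (fun _ : Fin (m j) => P)).prod (Measure.pi (fun _ : Fin (n j) => Q))
        {p : (Fin (m j) → X) × (Fin (n j) → X) |
          (empMeas (m j) p.1, empMeas (n j) p.2) ∈ Γ}) ≤ b := by
  set D := InformationTheory.klDiv (R : Measure X) P
  set D' := InformationTheory.klDiv (S : Measure X) Q
  have hfin := ENNReal.add_lt_top.1 (hb.trans_le le_top)
  have hD : D ≠ ⊤ := fun h => by
    rw [h, ENNReal.mul_top (by simpa using hc0)] at hfin
    exact lt_irrefl _ hfin.1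
  have hD' : D' ≠ ⊤ := fun h => by
    rw [h, ENNReal.mul_top (by simpa using hc1)] at hfin
    exact lt_irrefl _ hfin.2
  have hb' : c * D.toReal + (1 - c) * D'.toReal < b := by
    have h := (ENNReal.lt_ofReal_iff_toReal_lt hb.ne_top).1 hb
    rwa [ENNReal.toReal_add hfin.1.ne hfin.2.ne, ENNReal.toReal_mul, ENNReal.toReal_mul,
      ENNReal.toReal_ofReal hc0.le, ENNReal.toReal_ofReal (by linarith)] at h
  have hb0 : 0 ≤ b := by
    have h1 : 0 ≤ c * D.toReal := mul_nonneg hc0.le ENNReal.toReal_nonneg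
    have h2 : 0 ≤ (1 - c) * D'.toReal := mul_nonneg (by linarith) ENNReal.toReal_nonneg
    linarith
  rw [mem_interior_iff_mem_nhds, nhds_prod_eq] at hRS
  obtain ⟨U, hU, V, hV, hUV⟩ := Filter.mem_prod_iff.1 hRS
  set e : ℕ → ℝ≥0∞ := fun j =>
    (Measure.pi fun _ : Fin (m j) => (R : Measure X)) {x | empMeas (m j) x ∉ U}
      + (Measure.pi fun _ : Fin (n j) => (S : Measure X)) {x | empMeas (n j) x ∉ V} with he
  have he0 : Tendsto (fun j => (e j).toReal) atTop (𝓝 0) := by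
    rw [← ENNReal.toReal_zero]
    refine (ENNReal.tendsto_toReal ENNReal.zero_ne_top).comp ?_
    rw [← add_zero (0 : ℝ≥0∞)]
    exact ((tendsto_pi_empMeas_notMem R hU).comp hm).add
      ((tendsto_pi_empMeas_notMem S hV).comp hn)
  have hN : Tendsto (fun j => ((m j : ℝ) + n j)⁻¹) atTop (𝓝 0) :=
    tendsto_inv_atTop_zero.comp (tendsto_atTop_mono (fun j => le_add_of_nonneg_right
      (Nat.cast_nonneg _)) (tendsto_natCast_atTop_atTop.comp hm))
  have hlim : Tendsto (fun j => (m j : ℝ) / (m j + n j) * D.toReal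
      + (n j : ℝ) / (m j + n j) * D'.toReal + ((m j : ℝ) + n j)⁻¹ + b * (e j).toReal) atTop
      (𝓝 (c * D.toReal + (1 - c) * D'.toReal + 0 + b * 0)) :=
    (((hc.mul_const _).add ((tendsto_div_add_one_sub hm hc).mul_const _)).add hN).add
      (he0.const_mul b)
  filter_upwards [hlim.eventually_lt_const (by linarith), hm.eventually_gt_atTop 0]
    with j hj hmj
  set A := {p : (Fin (m j) → X) × (Fin (n j) → X) |
    (empMeas (m j) p.1, empMeas (n j) p.2) ∈ Γ}
  set μ := (Measure.pi (fun _ : Fin (m j) => P)).prod (Measure.pi (fun _ : Fin (n j) => Q))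
  set ν := (Measure.pi (fun _ : Fin (m j) => (R : Measure X))).prod
    (Measure.pi (fun _ : Fin (n j) => (S : Measure X)))
  have hNpos : 0 < m j + n j := by omega
  rw [← expRate_ofReal_exp hNpos b]
  refine expRate_anti _ ?_
  by_contra! hlt
  have h1 : ENNReal.ofReal ((m j + n j : ℕ) * b) * ν A ≤ m j * D + n j * D' + 1 := by
    refine (ofReal_mul_measure_le_klDiv_add ν μ _ A).trans (add_le_add ?_ ?_)
    · exact (klDiv_prod_le _ _ _ _).trans (add_le_add (klDiv_pi_le _ _ _) (klDiv_pi_le _ _ _))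
    · refine (mul_le_mul_right hlt.le _).trans_eq ?_
      rw [← ENNReal.ofReal_mul (Real.exp_pos _).le, ← Real.exp_add]
      simp
  have h2 : 1 ≤ ν A + e j := one_le_prod_add_measure_add_measure _ _ fun p h1 h2 =>
    hUV ⟨not_not.1 h1, not_not.1 h2⟩
  have hej : e j ≠ ⊤ := by simp [he]
  have h2' : 1 ≤ (ν A).toReal + (e j).toReal := by
    rw [← ENNReal.toReal_add (measure_ne_top _ _) hej, ← ENNReal.toReal_one]
    exact ENNReal.toReal_mono (by simp [hej]) h2
  have h1' : (m j + n j) * b * (ν A).toReal ≤ m j * D.toReal + n j * D'.toReal + 1 := by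
    have := ENNReal.toReal_mono (by finiteness) h1
    rw [ENNReal.toReal_add (by finiteness) (by finiteness),
      ENNReal.toReal_add (by finiteness) (by finiteness)] at this
    simp only [ENNReal.toReal_mul, ENNReal.toReal_natCast, ENNReal.toReal_one] at this
    rw [ENNReal.toReal_ofReal (by positivity)] at this
    exact_mod_cast this
  have hNr : (0 : ℝ) < m j + n j := by exact_mod_cast hNpos
  rw [div_mul_eq_mul_div, div_mul_eq_mul_div, ← add_div, ← one_div, ← add_div,
    ← lt_sub_iff_add_lt, div_lt_iff₀ hNr] at hj
  nlinarith [mul_le_mul_of_nonneg_left h2' (mul_nonneg hNr.le hb0)]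

theorem measure_pi_sum_ge_le {Y : Type*} [MeasurableSpace Y] (P : Measure Y)
    [IsProbabilityMeasure P] {f : Y → ℝ} (hf : Measurable f) (m : ℕ) (s : ℝ) :
    (Measure.pi fun _ : Fin m => P) {x | s ≤ ∑ i, f (x i)}
      ≤ ENNReal.ofReal (Real.exp (-s)) * (∫⁻ y, ENNReal.ofReal (Real.exp (f y)) ∂P) ^ m := by
  have h := measure_prod_pi_sum_ge_le P P hf (measurable_const (a := (0 : ℝ))) m 0 s
  have hset : {p : (Fin m → Y) × (Fin 0 → Y) | s ≤ ∑ i, f (p.1 i) + ∑ _ : Fin 0, (0 : ℝ)}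
      = {x | s ≤ ∑ i, f (x i)} ×ˢ Set.univ := by
    ext p
    simp
  rw [hset, Measure.prod_prod] at h
  simpa using h

/-- Exponential tightness of the laws of the empirical measures. -/
theorem exists_isCompact_measure_pi_empMeas_notMem_le {X : Type*} [MeasurableSpace X]
    [TopologicalSpace X] [PolishSpace X] [BorelSpace X] [Nonempty X] (P : Measure X)
    [IsProbabilityMeasure P] {a : ℝ} (ha : 0 ≤ a) :
    ∃ K : Set (ProbabilityMeasure X), IsCompact K ∧ ∀ m : ℕ, 0 < m →
      (Measure.pi fun _ : Fin m => P) {x | empMeas m x ∉ K}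
        ≤ ENNReal.ofReal (Real.exp (-(m * a))) := by
  let := TopologicalSpace.upgradeIsCompletelyMetrizable X
  set t : ℕ → ℝ := fun k => (k + 1) * (k + 2 + a) with ht
  have htight : IsTightMeasureSet {P} := isTightMeasureSet_singleton
  rw [isTightMeasureSet_iff_exists_isCompact_measure_compl_le] at htight
  have hC (k : ℕ) : ∃ C : Set X, IsCompact C ∧ P Cᶜ ≤ ENNReal.ofReal (Real.exp (-t k)) := by
    obtain ⟨C, h1, h2⟩ := htight (ENNReal.ofReal (Real.exp (-t k)))
      (ENNReal.ofReal_pos.2 (Real.exp_pos _))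
    exact ⟨C, h1, h2 P rfl⟩
  choose C hCc hCP using hC
  have hCm (k : ℕ) : MeasurableSet (C k)ᶜ := (hCc k).isClosed.measurableSet.compl
  set u : ℕ → NNReal := fun k => 1 / ((k : NNReal) + 1)
  refine ⟨{R | ∀ k, R (C k)ᶜ ≤ u k},
    isCompact_setOfPred_probabilityMeasure_mass_eq_compl_isCompact_le
      tendsto_one_div_add_atTop_nhds_zero_nat hCc (Or.inl inferInstance), fun m hm => ?_⟩
  have hm1 : (1 : ℝ) ≤ m := by exact_mod_cast hm
  have hone (k : ℕ) : (Measure.pi fun _ : Fin m => P) {x | u k < empMeas m x (C k)ᶜ}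
      ≤ ENNReal.ofReal (Real.exp (-(m * a))) * (2⁻¹) ^ (k + 1) := by
    set f : X → ℝ := (C k)ᶜ.indicator fun _ => t k
    have hf : Measurable f := measurable_const.indicator (hCm k)
    have htk : 0 ≤ t k := by positivity
    have hint : ∫⁻ y, ENNReal.ofReal (Real.exp (f y)) ∂P ≤ ENNReal.ofReal (Real.exp 1) := by
      calc ∫⁻ y, ENNReal.ofReal (Real.exp (f y)) ∂P
          ≤ ∫⁻ y, (1 + (C k)ᶜ.indicator (fun _ => ENNReal.ofReal (Real.exp (t k))) y) ∂P := by
            refine lintegral_mono fun y => ?_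
            by_cases hy : y ∈ (C k)ᶜ
            · simp only [f, Set.indicator_of_mem hy]
              exact le_add_self
            · simp [f, Set.indicator_of_notMem hy]
        _ = 1 + ENNReal.ofReal (Real.exp (t k)) * P (C k)ᶜ := by
            rw [lintegral_add_left measurable_const, lintegral_indicator_const (hCm k)]
            simp
        _ ≤ 1 + ENNReal.ofReal (Real.exp (t k)) * ENNReal.ofReal (Real.exp (-t k)) := by
            gcongr
            exact hCP k
        _ = ENNReal.ofReal 2 := by
            rw [← ENNReal.ofReal_mul (Real.exp_pos _).le, ← Real.exp_add]
            norm_num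
        _ ≤ _ := ENNReal.ofReal_le_ofReal (by linarith [Real.add_one_le_exp (1 : ℝ)])
    calc (Measure.pi fun _ : Fin m => P) {x | u k < empMeas m x (C k)ᶜ}
        ≤ (Measure.pi fun _ : Fin m => P) {x | m * (k + 2 + a) ≤ ∑ i, f (x i)} := by
          refine measure_mono fun x hx => ?_
          have h1 := integral_empMeas hm x hf
          rw [integral_indicator_const _ (hCm k), smul_eq_mul] at h1
          have hx' : (u k : ℝ) < (empMeas m x : Measure X).real (C k)ᶜ := hx
          have hu : (u k : ℝ) = 1 / (k + 1) := by simp [u]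
          have h2 : (k + 2 + a : ℝ) ≤ (empMeas m x : Measure X).real (C k)ᶜ * t k := by
            calc (k + 2 + a : ℝ) = u k * t k := by
                  rw [hu, ht]
                  field_simp
              _ ≤ _ := mul_le_mul_of_nonneg_right hx'.le htk
          rw [h1, ← div_eq_inv_mul, le_div_iff₀ (by positivity)] at h2
          exact (mul_comm _ _).trans_le h2
      _ ≤ ENNReal.ofReal (Real.exp (-(m * (k + 2 + a))))
          * (ENNReal.ofReal (Real.exp 1)) ^ m :=
          (measure_pi_sum_ge_le P hf m _).trans (by gcongr)
      _ = ENNReal.ofReal (Real.exp (-(m * a))) * ENNReal.ofReal (Real.exp (-(m * (k + 1)))) := by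
          rw [← ENNReal.ofReal_pow (Real.exp_pos _).le, ← Real.exp_nat_mul,
            ← ENNReal.ofReal_mul (Real.exp_pos _).le, ← ENNReal.ofReal_mul (Real.exp_pos _).le,
            ← Real.exp_add, ← Real.exp_add]
          congr 2
          ring
      _ ≤ _ := by
          refine mul_le_mul_right ?_ _
          have h2 : ((2 : ℝ≥0∞)⁻¹) ^ (k + 1) = ENNReal.ofReal ((2⁻¹ : ℝ) ^ (k + 1)) := by
            rw [ENNReal.ofReal_pow (by norm_num), ENNReal.ofReal_inv_of_pos (by norm_num)]
            simp
          rw [h2]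
          refine ENNReal.ofReal_le_ofReal ?_
          calc Real.exp (-(m * (k + 1))) ≤ Real.exp ((k + 1 : ℕ) * (-1)) := by
                refine Real.exp_le_exp.2 ?_
                push_cast
                nlinarith [k.cast_nonneg (α := ℝ)]
            _ = Real.exp (-1) ^ (k + 1) := Real.exp_nat_mul _ _
            _ ≤ _ := by
                gcongr
                rw [Real.exp_neg]
                exact inv_anti₀ (by norm_num) (by linarith [Real.add_one_le_exp (1 : ℝ)])
  calc (Measure.pi fun _ : Fin m => P) {x | empMeas m x ∉ {R | ∀ k, R (C k)ᶜ ≤ u k}}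
      ≤ (Measure.pi fun _ : Fin m => P) (⋃ k, {x | u k < empMeas m x (C k)ᶜ}) := by
        refine measure_mono fun x hx => ?_
        simpa using hx
    _ ≤ ∑' k, (Measure.pi fun _ : Fin m => P) {x | u k < empMeas m x (C k)ᶜ} :=
        measure_iUnion_le _
    _ ≤ ∑' k : ℕ, ENNReal.ofReal (Real.exp (-(m * a))) * (2⁻¹) ^ (k + 1) :=
        ENNReal.tsum_le_tsum hone
    _ = _ := by
        rw [ENNReal.tsum_mul_left, ENNReal.tsum_geometric_add_one, ENNReal.one_sub_inv_two,
          inv_inv, ENNReal.inv_mul_cancel (by simp) (by simp), mul_one]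

theorem lintegral_ofReal_exp_le {X : Type*} [MeasurableSpace X] [TopologicalSpace X]
    [BorelSpace X] (P : Measure X) [IsProbabilityMeasure P] (f : BoundedContinuousFunction X ℝ) :
    ∫⁻ x, ENNReal.ofReal (Real.exp (f x)) ∂P
      ≤ ENNReal.ofReal (Real.exp (∫ x, (Real.exp (f x) - 1) ∂P)) := by
  have hint : Integrable (fun x => Real.exp (f x)) P :=
    Integrable.of_bound (Real.continuous_exp.comp f.continuous).measurable.aestronglyMeasurable
      (Real.exp ‖f‖) (Eventually.of_forall fun x => by
        rw [Real.norm_eq_abs, Real.abs_exp]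
        exact Real.exp_le_exp.2 ((le_abs_self _).trans (f.norm_coe_le_norm x)))
  rw [← ofReal_integral_eq_lintegral_ofReal hint
    (Eventually.of_forall fun _ => (Real.exp_pos _).le)]
  refine ENNReal.ofReal_le_ofReal ?_
  rw [integral_sub hint (integrable_const 1)]
  have := Real.add_one_le_exp (∫ x, Real.exp (f x) ∂P - 1)
  simpa using this

theorem exists_mem_nhds_eventually_measure_le {X : Type*} [MeasurableSpace X]
    [TopologicalSpace X] [PolishSpace X] [BorelSpace X] [Nonempty X]
    (P Q : Measure X) [IsProbabilityMeasure P] [IsProbabilityMeasure Q]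
    {m n : ℕ → ℕ} (hm : Tendsto m atTop atTop) (hn : Tendsto n atTop atTop)
    {c : ℝ} (hc0 : 0 < c) (hc1 : c < 1)
    (hc : Tendsto (fun j : ℕ => (m j : ℝ) / (m j + n j)) atTop (𝓝 c))
    {R S : ProbabilityMeasure X} {b : ℝ} (hb0 : 0 ≤ b)
    (hb : ENNReal.ofReal b < ENNReal.ofReal c * InformationTheory.klDiv (R : Measure X) P
      + ENNReal.ofReal (1 - c) * InformationTheory.klDiv (S : Measure X) Q) :
    ∃ U ∈ 𝓝 (R, S), ∀ᶠ j in atTop,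
      (Measure.pi (fun _ : Fin (m j) => P)).prod (Measure.pi (fun _ : Fin (n j) => Q))
        {p : (Fin (m j) → X) × (Fin (n j) → X) | (empMeas (m j) p.1, empMeas (n j) p.2) ∈ U}
      ≤ ENNReal.ofReal (Real.exp (-((m j + n j : ℕ) * b))) := by
  have hc1' : 0 ≤ 1 - c := by linarith
  have hne (T T' : Measure X) [IsProbabilityMeasure T] [IsProbabilityMeasure T'] :
      Nonempty {g : BoundedContinuousFunction X ℝ //
        0 ≤ ∫ x, g x ∂T - ∫ x, (Real.exp (g x) - 1) ∂T'} := ⟨⟨0, by simp⟩⟩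
  have := hne R P
  have := hne S Q
  obtain ⟨⟨f, hf⟩, ⟨g, hg⟩, hfg⟩ : ∃ (f : {f : BoundedContinuousFunction X ℝ //
        0 ≤ ∫ x, f x ∂(R : Measure X) - ∫ x, (Real.exp (f x) - 1) ∂P})
      (g : {g : BoundedContinuousFunction X ℝ //
        0 ≤ ∫ x, g x ∂(S : Measure X) - ∫ x, (Real.exp (g x) - 1) ∂Q}),
      ENNReal.ofReal b < ENNReal.ofReal c * ENNReal.ofReal
          (∫ x, f.1 x ∂(R : Measure X) - ∫ x, (Real.exp (f.1 x) - 1) ∂P)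
        + ENNReal.ofReal (1 - c) * ENNReal.ofReal
          (∫ x, g.1 x ∂(S : Measure X) - ∫ x, (Real.exp (g.1 x) - 1) ∂Q) := by
    have h := hb.trans_le (add_le_add
      (mul_le_mul_right (klDiv_le_iSup_boundedContinuous (R : Measure X) P) _)
      (mul_le_mul_right (klDiv_le_iSup_boundedContinuous (S : Measure X) Q) _))
    rw [ENNReal.mul_iSup, ENNReal.mul_iSup, ENNReal.iSup_add] at h
    simp_rw [ENNReal.add_iSup] at h
    obtain ⟨f, h⟩ := lt_iSup_iff.1 h
    exact ⟨f, lt_iSup_iff.1 h⟩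
  simp only at hfg
  rw [← ENNReal.ofReal_mul hc0.le, ← ENNReal.ofReal_mul hc1',
    ← ENNReal.ofReal_add (mul_nonneg hc0.le hf) (mul_nonneg hc1' hg),
    ENNReal.ofReal_lt_ofReal_iff_of_nonneg hb0] at hfg
  set Λf := ∫ x, (Real.exp (f x) - 1) ∂P
  set Λg := ∫ x, (Real.exp (g x) - 1) ∂Q
  set δ := c * (∫ x, f x ∂(R : Measure X) - Λf)
    + (1 - c) * (∫ x, g x ∂(S : Measure X) - Λg) - b with hδ
  have hδ0 : 0 < δ := by linarith
  let L : ProbabilityMeasure X × ProbabilityMeasure X → ℝ := fun T =>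
    c * (∫ x, f x ∂(T.1 : Measure X) - Λf) + (1 - c) * (∫ x, g x ∂(T.2 : Measure X) - Λg)
  have hL : Continuous L := by
    have h1 := (ProbabilityMeasure.continuous_integral_boundedContinuousFunction f).comp
      (continuous_fst (X := ProbabilityMeasure X) (Y := ProbabilityMeasure X))
    have h2 := (ProbabilityMeasure.continuous_integral_boundedContinuousFunction g).comp
      (continuous_snd (X := ProbabilityMeasure X) (Y := ProbabilityMeasure X))
    exact ((h1.sub continuous_const).const_mul c).add ((h2.sub continuous_const).const_mul _)
  refine ⟨{T | b + δ / 2 < L T}, (isOpen_lt continuous_const hL).mem_nhds ?_, ?_⟩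
  · change b + δ / 2 < L (R, S)
    simp only [L]
    linarith
  have hlim : Tendsto (fun j => |(m j : ℝ) / (m j + n j) - c| * (‖f‖ + |Λf|)
      + |(n j : ℝ) / (m j + n j) - (1 - c)| * (‖g‖ + |Λg|)) atTop
      (𝓝 (|c - c| * (‖f‖ + |Λf|) + |(1 - c) - (1 - c)| * (‖g‖ + |Λg|))) :=
    ((hc.sub_const c).abs.mul_const _).add
      (((tendsto_div_add_one_sub hm hc).sub_const _).abs.mul_const _)
  filter_upwards [hlim.eventually_lt_const (u := δ / 2) (by simpa using hδ0),
    hm.eventually_gt_atTop 0, hn.eventually_gt_atTop 0] with j hj hmj hnj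
  have hmr : (0 : ℝ) < m j := Nat.cast_pos.2 hmj
  have hnr : (0 : ℝ) < n j := Nat.cast_pos.2 hnj
  have habs (T : ProbabilityMeasure X) (h : BoundedContinuousFunction X ℝ) :
      |∫ x, h x ∂(T : Measure X)| ≤ ‖h‖ := by
    simpa using h.norm_integral_le_norm (T : Measure X)
  calc _ ≤ (Measure.pi (fun _ : Fin (m j) => P)).prod (Measure.pi (fun _ : Fin (n j) => Q))
        {p | (m j + n j) * b + m j * Λf + n j * Λg ≤ ∑ i, f (p.1 i) + ∑ i, g (p.2 i)} := by
        refine measure_mono fun p hp => ?_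
        have hp' : b + δ / 2 < L (empMeas (m j) p.1, empMeas (n j) p.2) := hp
        have hF := integral_empMeas hmj p.1 f.continuous.measurable
        have hG := integral_empMeas hnj p.2 g.continuous.measurable
        have hF' := habs (empMeas (m j) p.1) f
        have hG' := habs (empMeas (n j) p.2) g
        simp only [L] at hp'
        set F := ∫ x, f x ∂(empMeas (m j) p.1 : Measure X)
        set G := ∫ x, g x ∂(empMeas (n j) p.2 : Measure X)
        rw [eq_inv_mul_iff_mul_eq₀ hmr.ne'] at hF
        rw [eq_inv_mul_iff_mul_eq₀ hnr.ne'] at hG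
        change (m j + n j) * b + m j * Λf + n j * Λg ≤ ∑ i, f (p.1 i) + ∑ i, g (p.2 i)
        rw [← hF, ← hG]
        set r := (m j : ℝ) / (m j + n j) with hr
        set r' := (n j : ℝ) / (m j + n j) with hr'
        have h1 : -(|r - c| * (‖f‖ + |Λf|)) ≤ (r - c) * (F - Λf) := by
          refine (neg_le_neg ?_).trans (neg_abs_le _)
          rw [abs_mul]
          gcongr
          exact (abs_sub _ _).trans (by gcongr)
        have h2 : -(|r' - (1 - c)| * (‖g‖ + |Λg|)) ≤ (r' - (1 - c)) * (G - Λg) := by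
          refine (neg_le_neg ?_).trans (neg_abs_le _)
          rw [abs_mul]
          gcongr
          exact (abs_sub _ _).trans (by gcongr)
        have h3 : b ≤ r * (F - Λf) + r' * (G - Λg) := by linarith
        rw [hr, hr', div_mul_eq_mul_div, div_mul_eq_mul_div, ← add_div,
          le_div_iff₀ (by positivity)] at h3
        linarith
    _ ≤ ENNReal.ofReal (Real.exp (-((m j + n j) * b + m j * Λf + n j * Λg)))
        * (ENNReal.ofReal (Real.exp Λf) ^ m j * ENNReal.ofReal (Real.exp Λg) ^ n j) := by
        refine (measure_prod_pi_sum_ge_le P Q f.continuous.measurable g.continuous.measurable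
          _ _ _).trans ?_
        gcongr
        · exact lintegral_ofReal_exp_le P f
        · exact lintegral_ofReal_exp_le Q g
    _ = _ := by
        rw [← ENNReal.ofReal_pow (Real.exp_pos _).le, ← ENNReal.ofReal_pow (Real.exp_pos _).le,
          ← Real.exp_nat_mul, ← Real.exp_nat_mul, ← ENNReal.ofReal_mul (Real.exp_pos _).le,
          ← ENNReal.ofReal_mul (Real.exp_pos _).le, ← Real.exp_add, ← Real.exp_add]
        congr 2
        push_cast
        ring

theorem eventually_le_expRate_of_forall_closure {X : Type*} [MeasurableSpace X]
    [TopologicalSpace X] [PolishSpace X] [BorelSpace X] [Nonempty X]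
    (P Q : Measure X) [IsProbabilityMeasure P] [IsProbabilityMeasure Q]
    {m n : ℕ → ℕ} (hm : Tendsto m atTop atTop) (hn : Tendsto n atTop atTop)
    {c : ℝ} (hc0 : 0 < c) (hc1 : c < 1)
    (hc : Tendsto (fun j : ℕ => (m j : ℝ) / (m j + n j)) atTop (𝓝 c))
    {Γ : Set (ProbabilityMeasure X × ProbabilityMeasure X)} {b b₁ : ℝ} (hb0 : 0 ≤ b)
    (hbb₁ : b < b₁) (hb₁ : ∀ RS ∈ closure Γ, ENNReal.ofReal b₁
      < ENNReal.ofReal c * InformationTheory.klDiv (RS.1 : Measure X) P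
        + ENNReal.ofReal (1 - c) * InformationTheory.klDiv (RS.2 : Measure X) Q) :
    ∀ᶠ j in atTop, (b : EReal) ≤ expRate (m j + n j)
      ((Measure.pi (fun _ : Fin (m j) => P)).prod (Measure.pi (fun _ : Fin (n j) => Q))
        {p : (Fin (m j) → X) × (Fin (n j) → X) |
          (empMeas (m j) p.1, empMeas (n j) p.2) ∈ Γ}) := by
  have hc1' : 0 < 1 - c := by linarith
  have hb₁0 : 0 ≤ b₁ := hb0.trans hbb₁.le
  let μ : (j : ℕ) → Measure ((Fin (m j) → X) × (Fin (n j) → X)) := fun j =>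
    (Measure.pi (fun _ : Fin (m j) => P)).prod (Measure.pi (fun _ : Fin (n j) => Q))
  let E : Set (ProbabilityMeasure X × ProbabilityMeasure X) → (j : ℕ) →
      Set ((Fin (m j) → X) × (Fin (n j) → X)) := fun s j =>
    {p | (empMeas (m j) p.1, empMeas (n j) p.2) ∈ s}
  obtain ⟨K, hK, hKle⟩ := exists_isCompact_measure_pi_empMeas_notMem_le P
    (a := 2 * b₁ / c) (by positivity)
  obtain ⟨K', hK', hK'le⟩ := exists_isCompact_measure_pi_empMeas_notMem_le Q
    (a := 2 * b₁ / (1 - c)) (by positivity)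
  obtain ⟨C, hC⟩ : ∃ C : ℕ, ∀ᶠ j in atTop, μ j (E (closure Γ ∩ K ×ˢ K') j)
      ≤ C * ENNReal.ofReal (Real.exp (-((m j + n j : ℕ) * b₁))) := by
    refine ((hK.prod hK').inter_left isClosed_closure).induction_on
      (p := fun s => ∃ C : ℕ, ∀ᶠ j in atTop, μ j (E s j)
        ≤ C * ENNReal.ofReal (Real.exp (-((m j + n j : ℕ) * b₁)))) ?_ ?_ ?_ ?_
    · exact ⟨0, Eventually.of_forall fun j => by simp [E]⟩
    · rintro s t hst ⟨C, hC⟩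
      exact ⟨C, hC.mono fun j hj => (measure_mono (t := E t j) fun p hp => hst hp).trans hj⟩
    · rintro s t ⟨C, hC⟩ ⟨C', hC'⟩
      refine ⟨C + C', (hC.and hC').mono fun j hj => ?_⟩
      calc μ j (E (s ∪ t) j) ≤ μ j (E s j) + μ j (E t j) := measure_union_le (E s j) (E t j)
        _ ≤ _ := (add_le_add hj.1 hj.2).trans_eq (by push_cast; ring)
    · rintro ⟨R, S⟩ hRS
      obtain ⟨U, hU, h⟩ := exists_mem_nhds_eventually_measure_le P Q hm hn hc0 hc1 hc hb₁0
        (hb₁ _ hRS.1)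
      exact ⟨U, mem_nhdsWithin_of_mem_nhds hU, 1, h.mono fun j hj => by simpa using hj⟩
  have hNtop : Tendsto (fun j => (m j : ℝ) + n j) atTop atTop :=
    tendsto_atTop_mono (fun j => le_add_of_nonneg_right (Nat.cast_nonneg _))
      (tendsto_natCast_atTop_atTop.comp hm)
  have hexp := Real.tendsto_exp_atTop.comp (hNtop.atTop_mul_const (sub_pos.2 hbb₁))
  filter_upwards [hC, hm.eventually_gt_atTop 0, hn.eventually_gt_atTop 0,
    hc.eventually_const_lt (show c / 2 < c by linarith),
    (tendsto_div_add_one_sub hm hc).eventually_const_lt (show (1 - c) / 2 < 1 - c by linarith),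
    hexp.eventually_ge_atTop ((C : ℝ) + 2)] with j hCj hmj hnj hmc hnc hej
  have hNpos : 0 < m j + n j := by omega
  have hNr : (0 : ℝ) < m j + n j := by exact_mod_cast hNpos
  rw [← expRate_ofReal_exp hNpos b]
  refine expRate_anti _ ?_
  have hrate {k : ℕ} {d : ℝ} (hd : 0 < d) (hk : d / 2 < (k : ℝ) / (m j + n j)) :
      ENNReal.ofReal (Real.exp (-(k * (2 * b₁ / d))))
        ≤ ENNReal.ofReal (Real.exp (-((m j + n j : ℕ) * b₁))) := by
    refine ENNReal.ofReal_le_ofReal (Real.exp_le_exp.2 (neg_le_neg ?_))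
    rw [lt_div_iff₀ hNr] at hk
    rw [mul_div_assoc', le_div_iff₀ hd]
    push_cast
    nlinarith
  calc μ j (E Γ j) ≤ μ j (E (closure Γ ∩ K ×ˢ K') j
        ∪ ({x | empMeas (m j) x ∉ K} ×ˢ Set.univ ∪ Set.univ ×ˢ {x | empMeas (n j) x ∉ K'})) := by
        refine measure_mono fun p hp => ?_
        by_cases h1 : empMeas (m j) p.1 ∈ K
        · by_cases h2 : empMeas (n j) p.2 ∈ K'
          · exact Or.inl ⟨subset_closure hp, h1, h2⟩
          · exact Or.inr (Or.inr ⟨trivial, h2⟩)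
        · exact Or.inr (Or.inl ⟨h1, trivial⟩)
    _ ≤ μ j (E (closure Γ ∩ K ×ˢ K') j) + (μ j ({x | empMeas (m j) x ∉ K} ×ˢ Set.univ)
        + μ j (Set.univ ×ˢ {x | empMeas (n j) x ∉ K'})) :=
        (measure_union_le _ _).trans (by gcongr; exact measure_union_le _ _)
    _ = μ j (E (closure Γ ∩ K ×ˢ K') j)
        + ((Measure.pi fun _ : Fin (m j) => P) {x | empMeas (m j) x ∉ K}
          + (Measure.pi fun _ : Fin (n j) => Q) {x | empMeas (n j) x ∉ K'}) := by
        simp [μ, Measure.prod_prod]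
    _ ≤ C * ENNReal.ofReal (Real.exp (-((m j + n j : ℕ) * b₁)))
        + (ENNReal.ofReal (Real.exp (-((m j + n j : ℕ) * b₁)))
          + ENNReal.ofReal (Real.exp (-((m j + n j : ℕ) * b₁)))) :=
        add_le_add hCj (add_le_add ((hKle _ hmj).trans (hrate hc0 hmc))
          ((hK'le _ hnj).trans (hrate hc1' hnc)))
    _ = ENNReal.ofReal ((C + 2) * Real.exp (-((m j + n j : ℕ) * b₁))) := by
        rw [ENNReal.ofReal_mul (by positivity), ENNReal.ofReal_add (by positivity) (by norm_num)]
        simp only [ENNReal.ofReal_natCast, ENNReal.ofReal_ofNat]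
        ring
    _ ≤ ENNReal.ofReal (Real.exp (-((m j + n j : ℕ) * b))) := by
        refine ENNReal.ofReal_le_ofReal ?_
        calc (C + 2) * Real.exp (-((m j + n j : ℕ) * b₁))
            ≤ Real.exp ((m j + n j) * (b₁ - b)) * Real.exp (-((m j + n j : ℕ) * b₁)) :=
              mul_le_mul_of_nonneg_right hej (Real.exp_pos _).le
          _ = _ := by
              rw [← Real.exp_add]
              congr 1
              push_cast
              ring

/-- **Extended Sanov's theorem.** For independent i.i.d. samples from `P` and `Q` on a Polish
space, with sample sizes `m_k, n_k → ∞` and `m_k/(m_k+n_k) → c ∈ (0,1)`, and any set `Γ` of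
pairs of probability measures: the exponential rate (in `m_k + n_k`) of
`Prob((P̂_{m_k}, Q̂_{n_k}) ∈ Γ)` is bounded above by
`inf_{(R,S) ∈ int Γ} [c D(R‖P) + (1-c) D(S‖Q)]` and below by the corresponding infimum over
`cl Γ`, interiors and closures taken in the product of the weak topologies. -/
theorem extended_sanov_theorem {X : Type*} [MeasurableSpace X] [TopologicalSpace X]
    [PolishSpace X] [BorelSpace X] [Nonempty X]
    (P Q : Measure X) [IsProbabilityMeasure P] [IsProbabilityMeasure Q]
    (m n : ℕ → ℕ) (hm : Tendsto m atTop atTop) (hn : Tendsto n atTop atTop)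
    (c : ℝ) (hc0 : 0 < c) (hc1 : c < 1)
    (hc : Tendsto (fun j : ℕ => (m j : ℝ) / (m j + n j)) atTop (𝓝 c))
    (Γ : Set (ProbabilityMeasure X × ProbabilityMeasure X)) :
    limsup (fun j : ℕ => expRate (m j + n j)
        ((Measure.pi (fun _ : Fin (m j) => P)).prod (Measure.pi (fun _ : Fin (n j) => Q))
          {p : (Fin (m j) → X) × (Fin (n j) → X) |
            (empMeas (m j) p.1, empMeas (n j) p.2) ∈ Γ})) atTop
      ≤ ((⨅ RS ∈ interior Γ,
          ENNReal.ofReal c * klDiv (RS.1 : Measure X) P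
            + ENNReal.ofReal (1 - c) * klDiv (RS.2 : Measure X) Q : ℝ≥0∞) : EReal)
    ∧ ((⨅ RS ∈ closure Γ,
          ENNReal.ofReal c * klDiv (RS.1 : Measure X) P
            + ENNReal.ofReal (1 - c) * klDiv (RS.2 : Measure X) Q : ℝ≥0∞) : EReal)
      ≤ liminf (fun j : ℕ => expRate (m j + n j)
        ((Measure.pi (fun _ : Fin (m j) => P)).prod (Measure.pi (fun _ : Fin (n j) => Q))
          {p : (Fin (m j) → X) × (Fin (n j) → X) |
            (empMeas (m j) p.1, empMeas (n j) p.2) ∈ Γ})) atTop := by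
  simp_rw [klDiv_eq_informationTheory]
  refine ⟨le_of_forall_gt_imp_ge_of_dense fun y hy => ?_,
    le_of_forall_lt_imp_le_of_dense fun y hy => ?_⟩
  · obtain ⟨b, hb, hby⟩ := EReal.lt_iff_exists_real_btwn.1 hy
    have hb' := hb.trans_le (EReal.coe_le_coe_iff.2 (le_max_left b 0))
    rw [← EReal.coe_ennreal_ofReal, EReal.coe_ennreal_lt_coe_ennreal_iff, iInf_lt_iff] at hb'
    obtain ⟨RS, hb'⟩ := hb'
    obtain ⟨hRS, hb'⟩ := iInf_lt_iff.1 hb'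
    exact (limsup_le_of_le (by isBoundedDefault) (eventually_expRate_le_of_mem_interior P Q
      hm hn hc0 hc1 hc hRS hb')).trans hby.le
  · obtain ⟨b, hyb, hb⟩ := EReal.lt_iff_exists_real_btwn.1 hy
    refine hyb.le.trans (le_liminf_of_le (by isBoundedDefault) ?_)
    rcases lt_or_ge b 0 with hb0 | hb0
    · filter_upwards [hm.eventually_gt_atTop 0] with j hj
      have hNpos : 0 < m j + n j := by omega
      refine (EReal.coe_le_coe_iff.2 hb0.le).trans ?_
      rw [← expRate_ofReal_exp hNpos 0]
      exact expRate_anti _ (prob_le_one.trans_eq (by simp))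
    · obtain ⟨b₁, hbb₁, hb₁⟩ := EReal.lt_iff_exists_real_btwn.1 hb
      have hbb₁' := EReal.coe_lt_coe_iff.1 hbb₁
      refine eventually_le_expRate_of_forall_closure P Q hm hn hc0 hc1 hc hb0 hbb₁'
        fun RS hRS => ?_
      rw [← max_eq_left (hb0.trans hbb₁'.le), ← EReal.coe_ennreal_ofReal,
        EReal.coe_ennreal_lt_coe_ennreal_iff] at hb₁
      exact hb₁.trans_le (iInf₂_le RS hRS)
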